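/- arXiv:2406.15715 — 2 statements merged into one kernel-verified Lean document; each statement's English description precedes it below -/
import Mathlib

section
/- Let n ≥ 3 and let 1 < p, q < ∞ satisfy n/p − (n−1)/q = 2. Define the kernel k(x, y, s) = (|x − y| + |s|)^{2−n} for x, y ∈ ℝ^{n−1} and s ∈ ℝ, and for a nonnegative measurable function f on ℝ^{n−1} × ℝ set Tf(x) = ∫_{ℝ^{n−1}} ∫_ℝ k(x, y, s) f(y, s) ds dy. Then there is a constant C = C(n, p, q) such that ‖Tf‖_{L^q(ℝ^{n−1})} ≤ C ‖f‖_{L^p(ℝ^{n−1} × ℝ)} for every nonnegative measurable f; that is, T defines a bounded linear map from L^p(ℝ^n) to L^q(ℝ^{n−1}). -/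
open MeasureTheory

/-- The layer cake identity `∫ t in (0, u), t ^ (γ - 1) = u ^ γ / γ` for `u : [0, ∞]`. -/
theorem lintegral_Ioi_indicator_lt_rpow {γ : ℝ} (hγ : 0 < γ) (u : ENNReal) :
    ∫⁻ t in Set.Ioi (0 : ℝ),
      {t : ℝ | ENNReal.ofReal t < u}.indicator (fun t => ENNReal.ofReal (t ^ (γ - 1))) t
      = u ^ γ / ENNReal.ofReal γ := by
  have hms : MeasurableSet {t : ℝ | ENNReal.ofReal t < u} :=
    measurableSet_lt ENNReal.measurable_ofReal measurable_const
  rw [lintegral_indicator hms, Measure.restrict_restrict hms]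
  have key : ∀ r : ℝ, 0 ≤ r → ∫⁻ t in Set.Ioo (0 : ℝ) r, ENNReal.ofReal (t ^ (γ - 1))
      = ENNReal.ofReal r ^ γ / ENNReal.ofReal γ := by
    intro r hr
    have hint : IntegrableOn (fun t : ℝ => t ^ (γ - 1)) (Set.Ioc 0 r) := by
      rw [← intervalIntegrable_iff_integrableOn_Ioc_of_le hr]
      exact intervalIntegral.intervalIntegrable_rpow' (by linarith)
    rw [restrict_Ioo_eq_restrict_Ioc, ← ofReal_integral_eq_lintegral_ofReal hint,
      ← intervalIntegral.integral_of_le hr, integral_rpow (Or.inl (by linarith)),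
      ENNReal.ofReal_rpow_of_nonneg hr hγ.le, ← ENNReal.ofReal_div_of_pos hγ]
    · simp [hγ.ne']
    · filter_upwards [ae_restrict_mem measurableSet_Ioc] with t ht
      exact Real.rpow_nonneg ht.1.le _
  induction u with
  | top =>
    have : {t : ℝ | ENNReal.ofReal t < ⊤} ∩ Set.Ioi 0 = Set.Ioi 0 := by
      ext t; simp
    rw [this, ENNReal.top_rpow_of_pos hγ, ENNReal.top_div_of_ne_top ENNReal.ofReal_ne_top]
    refine ENNReal.eq_top_of_forall_nnreal_le fun r => ?_
    have hc : (0 : ℝ) ≤ ((r : ℝ) * γ) ^ (1 / γ) := by positivity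
    calc (r : ENNReal) = ENNReal.ofReal (((r : ℝ) * γ) ^ (1 / γ)) ^ γ / ENNReal.ofReal γ := by
          rw [ENNReal.ofReal_rpow_of_nonneg hc hγ.le, ← ENNReal.ofReal_div_of_pos hγ,
            ← Real.rpow_mul (by positivity)]
          simp [hγ.ne']
      _ = _ := (key _ hc).symm
      _ ≤ _ := lintegral_mono_set Set.Ioo_subset_Ioi_self
  | coe r =>
    have : {t : ℝ | ENNReal.ofReal t < r} ∩ Set.Ioi 0 = Set.Ioo 0 (r : ℝ) := by
      ext t
      simp only [Set.mem_inter_iff, Set.mem_ofPred_eq, Set.mem_Ioi, Set.mem_Ioo]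
      rw [and_comm]
      refine and_congr_right fun ht => ?_
      rw [ENNReal.ofReal_lt_iff_lt_toReal ht.le ENNReal.coe_ne_top]
      simp
    rw [this, key _ r.coe_nonneg]
    simp

/-- Scaling of the integral of a radial function. -/
theorem lintegral_comp_norm_smul {E : Type*} [NormedAddCommGroup E] [NormedSpace ℝ E]
    [FiniteDimensional ℝ E] [MeasurableSpace E] [BorelSpace E] (μ : Measure E)
    [μ.IsAddHaarMeasure] (φ : ℝ → ENNReal) {R : ℝ} (hR : 0 < R) :
    ∫⁻ x, φ ‖x‖ ∂μ = ENNReal.ofReal (R ^ Module.finrank ℝ E) * ∫⁻ x, φ (R * ‖x‖) ∂μ := by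
  have h : ∫⁻ x, φ ‖x‖ ∂(μ.map (R • ·)) = ∫⁻ x, φ (R * ‖x‖) ∂μ := by
    refine ((Homeomorph.smulOfNeZero R hR.ne').measurableEmbedding.lintegral_map _).trans ?_
    simp [norm_smul, abs_of_pos hR]
  rw [← h, Measure.map_addHaar_smul μ hR.ne', lintegral_smul_measure, smul_eq_mul, ← mul_assoc,
    ← ENNReal.ofReal_mul (by positivity), abs_of_pos (by positivity),
    mul_inv_cancel₀ (by positivity)]
  simp

theorem exists_lintegral_ball_norm_rpow_le {E : Type*} [NormedAddCommGroup E] [NormedSpace ℝ E]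
    [FiniteDimensional ℝ E] [Nontrivial E] [MeasurableSpace E] [BorelSpace E] (μ : Measure E)
    [μ.IsAddHaarMeasure] {a : ℝ} (ha : a < Module.finrank ℝ E) :
    ∃ C : ℝ, 0 < C ∧ ∀ R : ℝ, 0 < R →
      ∫⁻ x, (Set.Iio R).indicator (fun r => ENNReal.ofReal (r ^ (-a))) ‖x‖ ∂μ
        ≤ ENNReal.ofReal (C * R ^ (Module.finrank ℝ E - a)) := by
  set I := ∫⁻ x, (Set.Iio (1 : ℝ)).indicator (fun r => ENNReal.ofReal (r ^ (-a))) ‖x‖ ∂μ with hI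
  have hfin : I ≠ ⊤ := by
    have hint : IntegrableOn (fun x : E => ‖x‖ ^ (-a)) (Metric.ball 0 1) μ := by
      refine integrableOn_ball_of_norm_le_rpow (C := 1) Module.finrank_pos ha ?_ ?_
      · refine Filter.Eventually.of_forall fun x => ?_
        rw [Real.norm_of_nonneg (by positivity), one_mul]
      · exact (by fun_prop : Measurable fun x : E => ‖x‖ ^ (-a)).aestronglyMeasurable
    have h := hint.lintegral_lt_top.ne
    rw [← lintegral_indicator Metric.isOpen_ball.measurableSet] at h
    convert h using 3 with x
    simp [Set.indicator]
  refine ⟨I.toReal + 1, by positivity, fun R hR => ?_⟩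
  rw [lintegral_comp_norm_smul μ _ hR]
  have : ∀ x : E, (Set.Iio R).indicator (fun r => ENNReal.ofReal (r ^ (-a))) (R * ‖x‖)
      = ENNReal.ofReal (R ^ (-a)) *
        (Set.Iio (1 : ℝ)).indicator (fun r => ENNReal.ofReal (r ^ (-a))) ‖x‖ := by
    intro x
    have : R * ‖x‖ < R ↔ ‖x‖ < 1 := by
      constructor <;> intro h <;> nlinarith
    simp only [Set.indicator, Set.mem_Iio, this, mul_ite, mul_zero]
    rw [Real.mul_rpow hR.le (norm_nonneg _), ENNReal.ofReal_mul (by positivity)]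
  simp_rw [this]
  rw [lintegral_const_mul' _ _ ENNReal.ofReal_ne_top, ← hI, ← mul_assoc,
    ← ENNReal.ofReal_mul (by positivity), ← Real.rpow_natCast, ← Real.rpow_add hR, mul_comm,
    ENNReal.ofReal_mul (by positivity), ← sub_eq_add_neg]
  gcongr
  rw [← ENNReal.ofReal_toReal hfin]
  exact ENNReal.ofReal_le_ofReal (by simp)

theorem exists_lintegral_compl_ball_norm_rpow_le {E : Type*} [NormedAddCommGroup E]
    [NormedSpace ℝ E] [FiniteDimensional ℝ E] [Nontrivial E] [MeasurableSpace E] [BorelSpace E]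
    (μ : Measure E) [μ.IsAddHaarMeasure] {b : ℝ} (hb : Module.finrank ℝ E < b) :
    ∃ C : ℝ, 0 < C ∧ ∀ R : ℝ, 0 < R →
      ∫⁻ x, (Set.Ici R).indicator (fun r => ENNReal.ofReal (r ^ (-b))) ‖x‖ ∂μ
        ≤ ENNReal.ofReal (C * R ^ (Module.finrank ℝ E - b)) := by
  have hb0 : 0 < b := lt_of_le_of_lt (Nat.cast_nonneg _) hb
  set I := ∫⁻ x, (Set.Ici (1 : ℝ)).indicator (fun r => ENNReal.ofReal (r ^ (-b))) ‖x‖ ∂μ with hI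
  have hfin : I ≠ ⊤ := by
    have hint := ((integrable_one_add_norm (μ := μ) hb).const_mul (2 ^ b)).lintegral_lt_top.ne
    refine ne_top_of_le_ne_top hint (lintegral_mono fun x => ?_)
    simp only [Set.indicator, Set.mem_Ici]
    split_ifs with h
    · apply ENNReal.ofReal_le_ofReal
      have h1 : (2 * ‖x‖) ^ (-b) ≤ (1 + ‖x‖) ^ (-b) :=
        Real.rpow_le_rpow_of_nonpos (by positivity) (by linarith) (by linarith)
      rw [Real.mul_rpow (by positivity) (by positivity), Real.rpow_neg (by positivity) b] at h1
      rwa [inv_mul_le_iff₀ (by positivity)] at h1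
    · exact zero_le
  refine ⟨I.toReal + 1, by positivity, fun R hR => ?_⟩
  rw [lintegral_comp_norm_smul μ _ hR]
  have : ∀ x : E, (Set.Ici R).indicator (fun r => ENNReal.ofReal (r ^ (-b))) (R * ‖x‖)
      = ENNReal.ofReal (R ^ (-b)) *
        (Set.Ici (1 : ℝ)).indicator (fun r => ENNReal.ofReal (r ^ (-b))) ‖x‖ := by
    intro x
    have : R ≤ R * ‖x‖ ↔ 1 ≤ ‖x‖ := by
      constructor <;> intro h <;> nlinarith
    simp only [Set.indicator, Set.mem_Ici, this, mul_ite, mul_zero]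
    rw [Real.mul_rpow hR.le (norm_nonneg _), ENNReal.ofReal_mul (by positivity)]
  simp_rw [this]
  rw [lintegral_const_mul' _ _ ENNReal.ofReal_ne_top, ← hI, ← mul_assoc,
    ← ENNReal.ofReal_mul (by positivity), ← Real.rpow_natCast, ← Real.rpow_add hR, mul_comm,
    ENNReal.ofReal_mul (by positivity), ← sub_eq_add_neg]
  gcongr
  rw [← ENNReal.ofReal_toReal hfin]
  exact ENNReal.ofReal_le_ofReal (by simp)

/-- Distribution function estimate for an integral operator whose kernel splits into a part bounded
in the dual Lebesgue space and an integrable part. -/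
theorem meas_lt_lintegral_le_of_kernel_splitting {X Z : Type*} [MeasurableSpace X]
    [MeasurableSpace Z] {μ : Measure X} {ν : Measure Z} [SFinite μ] [SFinite ν]
    {p p' : ℝ} (hp : p'.HolderConjugate p) {k k₀ k₁ : X → Z → ENNReal}
    (hk : ∀ x z, k x z ≤ k₀ x z + k₁ x z)
    (hk₀ : Measurable (Function.uncurry k₀)) (hk₁ : ∀ x, Measurable (k₁ x))
    {t s M N : ENNReal} (ht : t ≠ 0) (ht' : t ≠ ⊤)
    (h₁ : ∀ x, (∫⁻ z, k₁ x z ^ p' ∂ν) ^ (1 / p') ≤ t)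
    (h₀ : ∀ x, ∫⁻ z, k₀ x z ∂ν ≤ M) (hsM : s * M ≤ t)
    (h₀' : ∀ z, ∫⁻ x, k₀ x z ∂μ ≤ N)
    {f : Z → ENNReal} (hf : Measurable f) (hfp : ∫⁻ z, f z ^ p ∂ν ≤ 1) :
    μ {x | t < (∫⁻ z, k x z * f z ∂ν) / 3} ≤
      N / t * ∫⁻ z, {z | s < f z}.indicator f z ∂ν := by
  have hms : MeasurableSet {z | s < f z} := measurableSet_lt measurable_const hf
  set g := {z | s < f z}.indicator f with hg
  have hgm : Measurable g := hf.indicator hms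
  have hk₀x : ∀ x, Measurable (k₀ x) := fun x => hk₀.of_uncurry_left
  have hGm : Measurable fun x => ∫⁻ z, k₀ x z * g z ∂ν :=
    Measurable.lintegral_prod_right' (f := fun w : X × Z => k₀ w.1 w.2 * g w.2)
      (hk₀.mul (hgm.comp measurable_snd))
  have hsub : {x | t < (∫⁻ z, k x z * f z ∂ν) / 3} ⊆ {x | t ≤ ∫⁻ z, k₀ x z * g z ∂ν} := by
    intro x hx
    simp only [Set.mem_ofPred_eq] at hx ⊢
    by_contra! hlt
    refine absurd hx (not_lt.mpr ?_)
    have hpt : ∀ z, k x z * f z ≤ k₁ x z * f z + k₀ x z * s + k₀ x z * g z := by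
      intro z
      have hfz : f z ≤ s + g z := by
        by_cases h : s < f z
        · simp [hg, h]
        · exact (not_lt.1 h).trans le_self_add
      calc k x z * f z ≤ (k₀ x z + k₁ x z) * f z := by gcongr; exact hk x z
        _ = k₁ x z * f z + k₀ x z * f z := by ring
        _ ≤ k₁ x z * f z + k₀ x z * (s + g z) := by gcongr
        _ = _ := by ring
    have hA : ∫⁻ z, k₁ x z * f z ∂ν ≤ t :=
      calc _ ≤ (∫⁻ z, k₁ x z ^ p' ∂ν) ^ (1 / p') * (∫⁻ z, f z ^ p ∂ν) ^ (1 / p) :=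
            ENNReal.lintegral_mul_le_Lp_mul_Lq ν hp (hk₁ x).aemeasurable hf.aemeasurable
        _ ≤ t * 1 := by
            gcongr
            · exact h₁ x
            · exact ENNReal.rpow_le_one hfp (by have := hp.symm.pos; positivity)
        _ = t := mul_one t
    have hB : ∫⁻ z, k₀ x z * s ∂ν ≤ t := by
      rw [lintegral_mul_const _ (hk₀x x), mul_comm]
      exact le_trans (by gcongr; exact h₀ x) hsM
    refine ENNReal.div_le_of_le_mul ?_
    calc ∫⁻ z, k x z * f z ∂ν
        ≤ ∫⁻ z, (k₁ x z * f z + k₀ x z * s + k₀ x z * g z) ∂ν := lintegral_mono hpt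
      _ = ∫⁻ z, k₁ x z * f z ∂ν + ∫⁻ z, k₀ x z * s ∂ν + ∫⁻ z, k₀ x z * g z ∂ν := by
          rw [lintegral_add_right _ (by fun_prop), lintegral_add_right _ (by fun_prop)]
      _ ≤ t + t + t := by gcongr
      _ = t * 3 := by ring
  calc μ {x | t < (∫⁻ z, k x z * f z ∂ν) / 3}
      ≤ μ {x | t ≤ ∫⁻ z, k₀ x z * g z ∂ν} := measure_mono hsub
    _ ≤ (∫⁻ x, ∫⁻ z, k₀ x z * g z ∂ν ∂μ) / t := meas_ge_le_lintegral_div hGm.aemeasurable ht ht'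
    _ = (∫⁻ z, ∫⁻ x, k₀ x z * g z ∂μ ∂ν) / t := by
        rw [lintegral_lintegral_swap]
        exact (hk₀.mul (hgm.comp measurable_snd)).aemeasurable
    _ ≤ (∫⁻ z, N * g z ∂ν) / t := by
        gcongr with z
        rw [lintegral_mul_const _ hk₀.of_uncurry_right]
        gcongr
        exact h₀' z
    _ = N / t * ∫⁻ z, g z ∂ν := by
        rw [lintegral_const_mul _ hgm]
        simp only [div_eq_mul_inv]
        ring

/-- Strong type bound, on the unit ball of `L^p`, for an integral operator whose kernel can be split
at each level `t` with power-like control of the integrable part. -/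
theorem lintegral_rpow_le_of_kernel_splitting {X Z : Type*} [MeasurableSpace X]
    [MeasurableSpace Z] {μ : Measure X} {ν : Measure Z} [SFinite μ] [SFinite ν]
    {p p' q a b B C : ℝ} (hp : p'.HolderConjugate p) (hq : 0 < q) (ha : 0 < 1 + a)
    (hB : 0 < B) (hC : 0 ≤ C) (hγ : q - 1 - b = (p - 1) * (1 + a))
    {k : X → Z → ENNReal} {k₀ k₁ : ℝ → X → Z → ENNReal}
    (hkm : Measurable (Function.uncurry k))
    (hk : ∀ t > 0, ∀ x z, k x z ≤ k₀ t x z + k₁ t x z)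
    (hk₀ : ∀ t, Measurable (Function.uncurry (k₀ t))) (hk₁ : ∀ t x, Measurable (k₁ t x))
    (h₁ : ∀ t > 0, ∀ x, (∫⁻ z, k₁ t x z ^ p' ∂ν) ^ (1 / p') ≤ ENNReal.ofReal t)
    (h₀ : ∀ t > 0, ∀ x, ∫⁻ z, k₀ t x z ∂ν ≤ ENNReal.ofReal (B * t ^ (-a)))
    (h₀' : ∀ t > 0, ∀ z, ∫⁻ x, k₀ t x z ∂μ ≤ ENNReal.ofReal (C * t ^ (-b))) :
    ∃ D : ℝ, 0 < D ∧ ∀ f : Z → ENNReal, Measurable f → ∫⁻ z, f z ^ p ∂ν ≤ 1 →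
      ∫⁻ x, (∫⁻ z, k x z * f z ∂ν) ^ q ∂μ ≤ ENNReal.ofReal D := by
  have hp1 : 1 < p := hp.symm.lt
  set γ := q - 1 - b with hγdef
  have hγ0 : 0 < γ := by rw [hγ]; exact mul_pos (by linarith) ha
  set D : ENNReal := 3 ^ q * ENNReal.ofReal q * ENNReal.ofReal C *
    (ENNReal.ofReal B ^ (p - 1) / ENNReal.ofReal γ) with hD
  have hDfin : D ≠ ⊤ := by
    have h1 : ENNReal.ofReal B ^ (p - 1) ≠ ⊤ :=
      ENNReal.rpow_ne_top_of_nonneg (by linarith) ENNReal.ofReal_ne_top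
    have h2 : (3 : ENNReal) ^ q ≠ ⊤ := ENNReal.rpow_ne_top_of_nonneg hq.le (by simp)
    have h3 : ENNReal.ofReal γ ≠ 0 := by simpa using hγ0
    exact ENNReal.mul_ne_top (ENNReal.mul_ne_top (ENNReal.mul_ne_top h2 ENNReal.ofReal_ne_top)
      ENNReal.ofReal_ne_top) (ENNReal.div_ne_top h1 h3)
  refine ⟨D.toReal + 1, by positivity, fun f hf hfp => ?_⟩
  suffices h : ∫⁻ x, (∫⁻ z, k x z * f z ∂ν) ^ q ∂μ ≤ D by
    refine h.trans ?_
    rw [← ENNReal.ofReal_toReal hDfin]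
    exact ENNReal.ofReal_le_ofReal (by simp)
  set T : X → ENNReal := fun x => (∫⁻ z, k x z * f z ∂ν) / 3 with hT
  have hTm : Measurable T :=
    (Measurable.lintegral_prod_right' (f := fun w : X × Z => k w.1 w.2 * f w.2)
      (hkm.mul (hf.comp measurable_snd))).div_const _
  have hTq : ∀ x, (∫⁻ z, k x z * f z ∂ν) ^ q = 3 ^ q * (ENNReal.ofReal q *
      ∫⁻ t in Set.Ioi (0 : ℝ),
        {t : ℝ | ENNReal.ofReal t < T x}.indicator (fun t => ENNReal.ofReal (t ^ (q - 1))) t) := by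
    intro x
    rw [lintegral_Ioi_indicator_lt_rpow hq, ENNReal.mul_div_cancel (by simpa using hq) (by simp),
      ← ENNReal.mul_rpow_of_nonneg _ _ hq.le, hT, ENNReal.mul_div_cancel (by simp) (by simp)]
  have hlevel : ∀ t ∈ Set.Ioi (0 : ℝ),
      ∫⁻ x, {t : ℝ | ENNReal.ofReal t < T x}.indicator (fun t => ENNReal.ofReal (t ^ (q - 1))) t ∂μ
      ≤ ENNReal.ofReal C * ∫⁻ z, f z *
        {t : ℝ | ENNReal.ofReal t < (ENNReal.ofReal B * f z) ^ (1 / (1 + a))}.indicator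
          (fun t => ENNReal.ofReal (t ^ (γ - 1))) t ∂ν := by
    intro t ht
    have ht : 0 < t := ht
    have hset : ∀ z, ENNReal.ofReal t < (ENNReal.ofReal B * f z) ^ (1 / (1 + a)) ↔
        ENNReal.ofReal (t ^ (1 + a) / B) < f z := by
      intro z
      rw [one_div, ENNReal.lt_rpow_inv_iff ha, ENNReal.ofReal_rpow_of_pos ht,
        ENNReal.ofReal_div_of_pos hB]
      rw [ENNReal.div_lt_iff (Or.inl (by simpa using hB)) (Or.inl ENNReal.ofReal_ne_top),
        mul_comm]
    have hmeas := meas_lt_lintegral_le_of_kernel_splitting (μ := μ) hp (hk t ht) (hk₀ t) (hk₁ t)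
      (t := ENNReal.ofReal t) (s := ENNReal.ofReal (t ^ (1 + a) / B)) (by simpa using ht)
      ENNReal.ofReal_ne_top (h₁ t ht) (h₀ t ht) (by
        rw [← ENNReal.ofReal_mul (by positivity)]
        refine ENNReal.ofReal_le_ofReal (le_of_eq ?_)
        rw [Real.rpow_add ht, Real.rpow_neg ht.le, Real.rpow_one]
        field_simp) (h₀' t ht) hf hfp
    calc ∫⁻ x, {t : ℝ | ENNReal.ofReal t < T x}.indicator
          (fun t => ENNReal.ofReal (t ^ (q - 1))) t ∂μ
        = ∫⁻ x, {x | ENNReal.ofReal t < T x}.indicator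
            (fun _ => ENNReal.ofReal (t ^ (q - 1))) x ∂μ := by
          simp only [Set.indicator, Set.mem_ofPred_eq]
      _ = ENNReal.ofReal (t ^ (q - 1)) * μ {x | ENNReal.ofReal t < T x} :=
          lintegral_indicator_const (measurableSet_lt measurable_const hTm) _
      _ ≤ ENNReal.ofReal (t ^ (q - 1)) * (ENNReal.ofReal (C * t ^ (-b)) / ENNReal.ofReal t *
            ∫⁻ z, {z | ENNReal.ofReal (t ^ (1 + a) / B) < f z}.indicator f z ∂ν) := by
          gcongr
      _ = ENNReal.ofReal C * (ENNReal.ofReal (t ^ (γ - 1)) *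
            ∫⁻ z, {z | ENNReal.ofReal (t ^ (1 + a) / B) < f z}.indicator f z ∂ν) := by
          rw [← mul_assoc, ← mul_assoc, ← ENNReal.ofReal_div_of_pos ht,
            ← ENNReal.ofReal_mul (by positivity), ← ENNReal.ofReal_mul (by positivity)]
          congr 2
          rw [hγdef, show q - 1 - b - 1 = (q - 1) + (-b) + (-1) by ring, Real.rpow_add ht _ (-1),
            Real.rpow_add ht _ (-b), Real.rpow_neg_one]
          ring
      _ = _ := by
          rw [← lintegral_const_mul]
          · congr 1
            refine lintegral_congr fun z => ?_
            simp only [Set.indicator, Set.mem_ofPred_eq, hset]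
            split_ifs <;> simp [mul_comm]
          · exact hf.indicator (measurableSet_lt measurable_const hf)
  have hmeasT : Measurable (Function.uncurry fun (x : X) (t : ℝ) =>
      {t : ℝ | ENNReal.ofReal t < T x}.indicator (fun t => ENNReal.ofReal (t ^ (q - 1))) t) := by
    have : MeasurableSet {w : X × ℝ | ENNReal.ofReal w.2 < T w.1} :=
      measurableSet_lt (by fun_prop) (hTm.comp measurable_fst)
    exact Measurable.indicator
      (f := fun w : X × ℝ => ENNReal.ofReal (w.2 ^ (q - 1))) (by fun_prop) this
  have hmeasZ : Measurable (Function.uncurry fun (t : ℝ) (z : Z) => f z *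
      {t : ℝ | ENNReal.ofReal t < (ENNReal.ofReal B * f z) ^ (1 / (1 + a))}.indicator
          (fun t => ENNReal.ofReal (t ^ (γ - 1))) t) := by
    have : MeasurableSet {w : ℝ × Z |
        ENNReal.ofReal w.1 < (ENNReal.ofReal B * f w.2) ^ (1 / (1 + a))} :=
      measurableSet_lt (by fun_prop) (by fun_prop)
    refine Measurable.mul (f := fun w : ℝ × Z => f w.2) (by fun_prop) ?_
    exact Measurable.indicator
      (f := fun w : ℝ × Z => ENNReal.ofReal (w.1 ^ (γ - 1))) (by fun_prop) this
  simp_rw [hTq]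
  rw [lintegral_const_mul' _ _ (ENNReal.rpow_ne_top_of_nonneg hq.le (by simp)),
    lintegral_const_mul' _ _ ENNReal.ofReal_ne_top, lintegral_lintegral_swap hmeasT.aemeasurable,
    hD]
  have hfin : ∀ z, ∫⁻ t in Set.Ioi (0 : ℝ), f z *
      {t : ℝ | ENNReal.ofReal t < (ENNReal.ofReal B * f z) ^ (1 / (1 + a))}.indicator
          (fun t => ENNReal.ofReal (t ^ (γ - 1))) t =
      ENNReal.ofReal B ^ (p - 1) / ENNReal.ofReal γ * f z ^ p := by
    intro z
    rw [lintegral_const_mul, lintegral_Ioi_indicator_lt_rpow hγ0, ← ENNReal.rpow_mul, hγ,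
      show 1 / (1 + a) * ((p - 1) * (1 + a)) = p - 1 by field_simp,
      ENNReal.mul_rpow_of_nonneg _ _ (by linarith : (0 : ℝ) ≤ p - 1)]
    · have : f z ^ p = f z * f z ^ (p - 1) := by
        conv_rhs => rw [← ENNReal.rpow_one (f z), ← ENNReal.rpow_mul, one_mul]
        rw [← ENNReal.rpow_add_of_nonneg _ _ zero_le_one (by linarith)]
        congr 1; ring
      rw [this, div_eq_mul_inv, div_eq_mul_inv]
      ring
    · exact Measurable.indicator (by fun_prop) (measurableSet_lt (by fun_prop) measurable_const)
  calc _ ≤ 3 ^ q * (ENNReal.ofReal q * ∫⁻ t in Set.Ioi (0 : ℝ), ENNReal.ofReal C * ∫⁻ z, f z *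
        {t : ℝ | ENNReal.ofReal t < (ENNReal.ofReal B * f z) ^ (1 / (1 + a))}.indicator
          (fun t => ENNReal.ofReal (t ^ (γ - 1))) t ∂ν) := by
        gcongr 3 ^ q * (ENNReal.ofReal q * ?_)
        exact setLIntegral_mono' measurableSet_Ioi hlevel
    _ = 3 ^ q * (ENNReal.ofReal q * (ENNReal.ofReal C *
          (ENNReal.ofReal B ^ (p - 1) / ENNReal.ofReal γ * ∫⁻ z, f z ^ p ∂ν))) := by
        rw [lintegral_const_mul' _ _ ENNReal.ofReal_ne_top,
          lintegral_lintegral_swap hmeasZ.aemeasurable]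
        simp_rw [hfin]
        rw [lintegral_const_mul _ (hf.pow_const p)]
    _ ≤ 3 ^ q * (ENNReal.ofReal q * (ENNReal.ofReal C *
          (ENNReal.ofReal B ^ (p - 1) / ENNReal.ofReal γ * 1))) := by gcongr
    _ = _ := by rw [mul_one]; ring

/-- A bound for an integral operator on the unit ball of `L^p` extends by homogeneity. -/
theorem lintegral_Lp_bound_of_unit_ball_bound {X Z : Type*} [MeasurableSpace X]
    [MeasurableSpace Z] {μ : Measure X} {ν : Measure Z} {p q D : ℝ} (hp : 0 < p) (hq : 0 < q)
    (hD : 0 < D) {k : X → Z → ENNReal} (hk : ∀ x, Measurable (k x))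
    (h : ∀ f : Z → ENNReal, Measurable f → ∫⁻ z, f z ^ p ∂ν ≤ 1 →
      ∫⁻ x, (∫⁻ z, k x z * f z ∂ν) ^ q ∂μ ≤ ENNReal.ofReal D)
    {f : Z → ENNReal} (hf : Measurable f) :
    (∫⁻ x, (∫⁻ z, k x z * f z ∂ν) ^ q ∂μ) ^ (1 / q) ≤
      ENNReal.ofReal (D ^ (1 / q)) * (∫⁻ z, f z ^ p ∂ν) ^ (1 / p) := by
  have hD' : ENNReal.ofReal (D ^ (1 / q)) ≠ 0 := by
    simpa using Real.rpow_pos_of_pos hD _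
  set N := ∫⁻ z, f z ^ p ∂ν with hN
  rcases eq_or_ne N 0 with h0 | h0
  · have hae : f =ᵐ[ν] 0 := by
      filter_upwards [(lintegral_eq_zero_iff (hf.pow_const p)).1 h0] with z hz
      simpa [hp, hp.le, hp.not_gt] using hz
    have hT : ∀ x, ∫⁻ z, k x z * f z ∂ν = 0 := by
      intro x
      rw [lintegral_congr_ae (g := fun _ => 0)]
      · simp
      · filter_upwards [hae] with z hz
        simp [hz]
    simp [hT, hq]
  rcases eq_or_ne N ⊤ with h1 | h1
  · rw [h1, ENNReal.top_rpow_of_pos (by positivity), ENNReal.mul_top hD']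
    exact le_top
  set c := N ^ (1 / p) with hc
  have hc0 : c ≠ 0 := by simp [hc, h0, h1]
  have hc1 : c ≠ ⊤ := ENNReal.rpow_ne_top_of_nonneg (by positivity) h1
  have hcp : c ^ p = N := by rw [hc, ← ENNReal.rpow_mul, one_div_mul_cancel hp.ne', ENNReal.rpow_one]
  have hb := h (fun z => c⁻¹ * f z) (hf.const_mul _) (by
    simp_rw [ENNReal.mul_rpow_of_nonneg _ _ hp.le]
    rw [lintegral_const_mul _ (hf.pow_const p), ENNReal.inv_rpow, hcp, ← hN,
      ENNReal.inv_mul_cancel h0 h1])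
  have hcq : c ^ q ≠ ⊤ := ENNReal.rpow_ne_top_of_nonneg hq.le hc1
  have hT : ∀ x, (∫⁻ z, k x z * f z ∂ν) ^ q =
      c ^ q * (∫⁻ z, k x z * (c⁻¹ * f z) ∂ν) ^ q := by
    intro x
    rw [← ENNReal.mul_rpow_of_nonneg _ _ hq.le,
      ← lintegral_const_mul _ (by fun_prop)]
    congr 1
    refine lintegral_congr fun z => ?_
    calc k x z * f z = (c * c⁻¹) * (k x z * f z) := by rw [ENNReal.mul_inv_cancel hc0 hc1, one_mul]
      _ = _ := by ring
  simp_rw [hT]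
  rw [lintegral_const_mul' _ _ hcq, ENNReal.mul_rpow_of_nonneg _ _ (by positivity),
    ← ENNReal.rpow_mul, mul_one_div_cancel hq.ne', ENNReal.rpow_one, mul_comm,
    ← ENNReal.ofReal_rpow_of_pos hD]
  gcongr

/-- The bound on the unit ball of `L^p(E × ℝ)` for the kernel `‖z - (x, 0)‖ ^ (1 - dim E)`. -/
theorem exists_lintegral_trace_kernel_rpow_le {E : Type*} [NormedAddCommGroup E]
    [NormedSpace ℝ E] [FiniteDimensional ℝ E] [Nontrivial E] [MeasurableSpace E] [BorelSpace E]
    (μ : Measure E) [μ.IsAddHaarMeasure] {m p q : ℝ} (hm : m = Module.finrank ℝ E)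
    (hp : 1 < p) (hq : 0 < q) (hpq : (m + 1) / p - m / q = 2) :
    ∃ D : ℝ, 0 < D ∧ ∀ f : E × ℝ → ENNReal, Measurable f →
      ∫⁻ z, f z ^ p ∂(μ.prod volume) ≤ 1 →
      ∫⁻ x, (∫⁻ z, ENNReal.ofReal (‖z - (x, 0)‖ ^ (-(m - 1))) * f z ∂(μ.prod volume)) ^ q ∂μ
        ≤ ENNReal.ofReal D := by
  have hm0 : 1 ≤ m := by
    rw [hm]
    exact_mod_cast (Module.finrank_pos (R := ℝ) (M := E))
  have hp0 : 0 < p := by linarith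
  set p' := p.conjExponent with hp'def
  have hp' : p'.HolderConjugate p := (Real.HolderConjugate.conjExponent hp).symm
  have hp'0 : 0 < p' := hp'.pos
  have hinv : 1 / p' = 1 - 1 / p := by
    have := hp'.inv_add_inv_eq_one
    rw [one_div, one_div]; linarith
  have hdim : (Module.finrank ℝ (E × ℝ) : ℝ) = m + 1 := by simp [hm]
  have hscale : (m + 1) * (1 / p') - (m - 1) = -(m / q) := by
    rw [hinv]; linear_combination -hpq
  have hb : (Module.finrank ℝ (E × ℝ) : ℝ) < (m - 1) * p' := by
    rw [hdim]
    have h1 : 0 < m / q := by positivity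
    have h2 : (m + 1) * (1 / p') < m - 1 := by linarith
    rwa [mul_one_div, div_lt_iff₀ hp'0] at h2
  obtain ⟨A, hA, hAle⟩ := exists_lintegral_compl_ball_norm_rpow_le (μ.prod (volume : Measure ℝ)) hb
  obtain ⟨B, hB, hBle⟩ := exists_lintegral_ball_norm_rpow_le (μ.prod (volume : Measure ℝ))
    (a := m - 1) (by rw [hdim]; linarith)
  obtain ⟨C, hC, hCle⟩ := exists_lintegral_ball_norm_rpow_le μ
    (a := m - 1) (by rw [← hm]; linarith)
  rw [hdim] at hAle hBle
  rw [← hm] at hCle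
  set α := A ^ (1 / p') with hα
  have hα0 : 0 < α := Real.rpow_pos_of_pos hA _
  set R : ℝ → ℝ := fun t => (α / t) ^ (q / m) with hR
  have hR0 : ∀ t > 0, 0 < R t := fun t ht => Real.rpow_pos_of_pos (by positivity) _
  have hRt : ∀ t > 0, R t = α ^ (q / m) * t ^ (-(q / m)) := by
    intro t ht
    simp only [hR]
    rw [Real.div_rpow hα0.le ht.le, Real.rpow_neg ht.le, div_eq_mul_inv]
  have hRpow : ∀ t > 0, R t ^ (-(m / q)) = t / α := by
    intro t ht
    simp only [hR]
    rw [← Real.rpow_mul (by positivity), show q / m * -(m / q) = -1 by field_simp,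
      Real.rpow_neg_one, inv_div]
  have hφ : Measurable fun r : ℝ => ENNReal.ofReal (r ^ (-(m - 1))) := by fun_prop
  refine lintegral_rpow_le_of_kernel_splitting (p' := p') (a := 2 * q / m) (b := q / m)
    (B := B * (α ^ (q / m)) ^ (2 : ℝ)) (C := C * α ^ (q / m))
    (k₀ := fun t x z =>
      (Set.Iio (R t)).indicator (fun r => ENNReal.ofReal (r ^ (-(m - 1)))) ‖z - (x, 0)‖)
    (k₁ := fun t x z =>
      (Set.Ici (R t)).indicator (fun r => ENNReal.ofReal (r ^ (-(m - 1)))) ‖z - (x, 0)‖)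
    hp' hq (by positivity) (by positivity) (by positivity) ?_ ?_ ?_ ?_ ?_ ?_ ?_ ?_
  · have hpq' : (m + 1) * q = p * (2 * q + m) := by
      field_simp at hpq
      linarith
    field_simp
    linarith
  · exact hφ.comp (by fun_prop : Measurable fun w : E × (E × ℝ) => ‖w.2 - (w.1, (0 : ℝ))‖)
  · intro t ht x z
    by_cases h : ‖z - (x, 0)‖ < R t
    · simp [Set.indicator, h]
    · simp [Set.indicator, h, not_lt.1 h]
  · intro t
    exact (hφ.indicator measurableSet_Iio).comp
      (by fun_prop : Measurable fun w : E × (E × ℝ) => ‖w.2 - (w.1, (0 : ℝ))‖)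
  · intro t x
    exact (hφ.indicator measurableSet_Ici).comp
      (by fun_prop : Measurable fun z : E × ℝ => ‖z - (x, (0 : ℝ))‖)
  · intro t ht x
    have hpow : ∀ z : E × ℝ,
        (Set.Ici (R t)).indicator (fun r => ENNReal.ofReal (r ^ (-(m - 1)))) ‖z - (x, 0)‖ ^ p'
        = (Set.Ici (R t)).indicator (fun r => ENNReal.ofReal (r ^ (-((m - 1) * p'))))
          ‖z - (x, 0)‖ := by
      intro z
      simp only [Set.indicator]
      split_ifs
      · rw [ENNReal.ofReal_rpow_of_nonneg (by positivity) hp'0.le,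
          ← Real.rpow_mul (norm_nonneg _), neg_mul]
      · simp [hp'0]
    simp_rw [hpow]
    rw [lintegral_sub_right_eq_self (fun z : E × ℝ => (Set.Ici (R t)).indicator
      (fun r => ENNReal.ofReal (r ^ (-((m - 1) * p')))) ‖z‖) (x, 0)]
    calc _ ≤ ENNReal.ofReal (A * R t ^ (m + 1 - (m - 1) * p')) ^ (1 / p') := by
          gcongr
          exact hAle _ (hR0 t ht)
      _ = ENNReal.ofReal t := by
          have := hR0 t ht
          rw [ENNReal.ofReal_rpow_of_nonneg (by positivity) (by positivity),
            Real.mul_rpow hA.le (by positivity), ← Real.rpow_mul this.le, ← hα,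
            show (m + 1 - (m - 1) * p') * (1 / p') = -(m / q) by
              rw [← hscale]; field_simp, hRpow t ht, mul_div_cancel₀ _ hα0.ne']
  · intro t ht x
    rw [lintegral_sub_right_eq_self (fun z : E × ℝ => (Set.Iio (R t)).indicator
      (fun r => ENNReal.ofReal (r ^ (-(m - 1)))) ‖z‖) (x, 0)]
    refine (hBle _ (hR0 t ht)).trans (ENNReal.ofReal_le_ofReal (le_of_eq ?_))
    rw [show m + 1 - (m - 1) = 2 by ring, hRt t ht, Real.mul_rpow (by positivity) (by positivity),
      ← Real.rpow_mul ht.le, mul_assoc, show -(q / m) * 2 = -(2 * q / m) by ring]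
  · intro t ht z
    have hae : ∀ᵐ x ∂μ,
        (Set.Iio (R t)).indicator (fun r => ENNReal.ofReal (r ^ (-(m - 1)))) ‖z - (x, 0)‖ ≤
        (Set.Iio (R t)).indicator (fun r => ENNReal.ofReal (r ^ (-(m - 1)))) ‖x - z.1‖ := by
      filter_upwards [compl_mem_ae_iff.2 (measure_singleton (μ := μ) z.1)] with x hx
      have hpos : 0 < ‖x - z.1‖ := norm_pos_iff.2 (sub_ne_zero.2 hx)
      have hle : ‖x - z.1‖ ≤ ‖z - (x, 0)‖ := by
        rw [norm_sub_rev]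
        exact norm_fst_le (z - (x, 0))
      by_cases h : ‖z - (x, 0)‖ < R t
      · simp only [Set.indicator, Set.mem_Iio, h, hle.trans_lt h, if_true]
        exact ENNReal.ofReal_le_ofReal
          (Real.rpow_le_rpow_of_nonpos hpos hle (by linarith))
      · simp [Set.indicator, h]
    refine (lintegral_mono_ae hae).trans ?_
    rw [lintegral_sub_right_eq_self (fun x : E => (Set.Iio (R t)).indicator
      (fun r => ENNReal.ofReal (r ^ (-(m - 1)))) ‖x‖) z.1]
    refine (hCle _ (hR0 t ht)).trans (ENNReal.ofReal_le_ofReal (le_of_eq ?_))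
    rw [show m - (m - 1) = 1 by ring, Real.rpow_one, hRt t ht, mul_assoc]

/-- The Sobolev-trace-type bound for the kernel
`k(x, y, s) = (|x − y| + |s|)^{2−n}` on `ℝ^{n−1} × ℝ`, mapping
`L^p(ℝ^n)` boundedly to `L^q(ℝ^{n−1})` when `n/p − (n−1)/q = 2`. -/
theorem stmt_0 (n : ℕ) (hn : 3 ≤ n) (p q : ℝ)
    (hp : 1 < p) (hq : 1 < q)
    (hpq : (n : ℝ) / p - ((n : ℝ) - 1) / q = 2) :
    ∃ C : ℝ, 0 ≤ C ∧
      ∀ f : (EuclideanSpace ℝ (Fin (n - 1)) × ℝ) → ℝ,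
        Measurable f → (∀ z, 0 ≤ f z) →
          (∫⁻ x : EuclideanSpace ℝ (Fin (n - 1)),
              (∫⁻ y : EuclideanSpace ℝ (Fin (n - 1)), ∫⁻ s : ℝ,
                ENNReal.ofReal ((‖x - y‖ + |s|) ^ (2 - (n : ℝ)) * f (y, s))) ^ q) ^ (1 / q)
            ≤ ENNReal.ofReal C *
              (∫⁻ z : EuclideanSpace ℝ (Fin (n - 1)) × ℝ,
                ENNReal.ofReal (f z) ^ p) ^ (1 / p) := by
  have hq0 : 0 < q := by linarith
  have hn' : (3 : ℝ) ≤ n := by exact_mod_cast hn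
  have : Nonempty (Fin (n - 1)) := ⟨⟨0, by omega⟩⟩
  obtain ⟨D, hD, hDle⟩ := exists_lintegral_trace_kernel_rpow_le
    (volume : Measure (EuclideanSpace ℝ (Fin (n - 1)))) (m := (n : ℝ) - 1) (p := p) (q := q)
    (by rw [finrank_euclideanSpace_fin, Nat.cast_sub (by omega), Nat.cast_one]) hp hq0
    (by rwa [sub_add_cancel])
  refine ⟨D ^ (1 / q), by positivity, fun f hf hf0 => ?_⟩
  refine le_trans ?_ (lintegral_Lp_bound_of_unit_ball_bound (by linarith : 0 < p) hq0 hD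
    (fun x => by fun_prop) hDle (f := fun z => ENNReal.ofReal (f z)) hf.ennreal_ofReal)
  gcongr with x
  rw [lintegral_prod _ (by fun_prop)]
  gcongr with y s
  rw [← ENNReal.ofReal_mul (by positivity)]
  refine ENNReal.ofReal_le_ofReal (mul_le_mul_of_nonneg_right ?_ (hf0 _))
  have hnorm : ‖((y, s) : EuclideanSpace ℝ (Fin (n - 1)) × ℝ) - (x, 0)‖ = max ‖x - y‖ |s| := by
    rw [norm_sub_rev x y]
    simp [Prod.norm_def]
  rw [hnorm, show -((n : ℝ) - 1 - 1) = 2 - n by ring]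
  have hle : max ‖x - y‖ |s| ≤ ‖x - y‖ + |s| :=
    max_le (le_add_of_nonneg_right (abs_nonneg s)) (le_add_of_nonneg_left (norm_nonneg _))
  rcases (le_max_of_le_left (norm_nonneg (x - y)) : 0 ≤ max ‖x - y‖ |s|).eq_or_lt with h | h
  · have h1 : ‖x - y‖ = 0 := le_antisymm (h ▸ le_max_left _ _) (norm_nonneg _)
    have h2 : |s| = 0 := le_antisymm (h ▸ le_max_right _ _) (abs_nonneg _)
    simp [h1, h2]
  · exact Real.rpow_le_rpow_of_nonpos h hle (by linarith)
end

section
/- Let n ≥ 3 and let 1 < p, q < ∞ satisfy n/p − (n−2)/q = 2. Define the kernel k(x, y, s) = (|x − y| + |s|)^{2−n} for x, y ∈ ℝ^{n−2} and s ∈ ℝ², and for a nonnegative measurable function f on ℝ^{n−2} × ℝ² set Tf(x) = ∫_{ℝ^{n−2}} ∫_{ℝ²} k(x, y, s) f(y, s) ds dy. Then there is a constant C = C(n, p, q) such that ‖Tf‖_{L^q(ℝ^{n−2})} ≤ C ‖f‖_{L^p(ℝ^{n−2} × ℝ²)} for every nonnegative measurable f; that is, T defines a bounded linear map from L^p(ℝ^n)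 to L^q(ℝ^{n−2}). -/
open MeasureTheory

open Set Metric Module
open scoped ENNReal

lemma lintegral_Ioo_zero_rpow {a : ℝ} (ha : 0 < a) {R : ℝ} (hR : 0 ≤ R) :
    ∫⁻ t in Ioo 0 R, ENNReal.ofReal (t ^ (a - 1)) = ENNReal.ofReal (R ^ a / a) := by
  have hint : IntegrableOn (fun t : ℝ => t ^ (a - 1)) (Ioo 0 R) := by
    rw [← integrableOn_Ioc_iff_integrableOn_Ioo, ← intervalIntegrable_iff_integrableOn_Ioc_of_le hR]
    exact intervalIntegral.intervalIntegrable_rpow' (by linarith)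
  rw [← ofReal_integral_eq_lintegral_ofReal hint, ← integral_Ioc_eq_integral_Ioo,
    ← intervalIntegral.integral_of_le hR, integral_rpow (Or.inl (by linarith))]
  · simp [Real.zero_rpow ha.ne']
  · exact (ae_restrict_iff' measurableSet_Ioo).2 (.of_forall fun t ht => Real.rpow_nonneg ht.1.le _)

lemma lintegral_Ioi_rpow {b : ℝ} (hb : 0 < b) {R : ℝ} (hR : 0 < R) :
    ∫⁻ t in Ioi R, ENNReal.ofReal (t ^ (-b - 1)) = ENNReal.ofReal (R ^ (-b) / b) := by
  rw [← ofReal_integral_eq_lintegral_ofReal (integrableOn_Ioi_rpow_of_lt (by linarith) hR),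
    integral_Ioi_rpow_of_lt (by linarith) hR]
  · rw [sub_add_cancel, neg_div_neg_eq]
  · exact (ae_restrict_iff' measurableSet_Ioi).2
      (.of_forall fun t ht => Real.rpow_nonneg (hR.trans ht).le _)

lemma lintegral_indicator_ofReal_lt_rpow {a : ℝ} (ha : 0 < a) (c : ℝ≥0∞) :
    ∫⁻ t in Ioi (0 : ℝ), {t : ℝ | ENNReal.ofReal t < c}.indicator
      (fun t => ENNReal.ofReal (t ^ (a - 1))) t = c ^ a / ENNReal.ofReal a := by
  have hmeas : MeasurableSet {t : ℝ | ENNReal.ofReal t < c} :=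
    measurableSet_lt ENNReal.measurable_ofReal measurable_const
  rw [setLIntegral_indicator hmeas]
  induction c with
  | top =>
    rw [ENNReal.top_rpow_of_pos ha, ENNReal.top_div_of_ne_top ENNReal.ofReal_ne_top]
    refine ENNReal.eq_top_of_forall_nnreal_le fun r => ?_
    have hr : (0 : ℝ) ≤ a * r := by positivity
    calc (r : ℝ≥0∞) = ENNReal.ofReal (((a * r) ^ (1 / a)) ^ a / a) := by
          rw [← Real.rpow_mul hr, one_div_mul_cancel ha.ne', Real.rpow_one,
            mul_div_cancel_left₀ _ ha.ne', ENNReal.ofReal_coe_nnreal]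
      _ = ∫⁻ t in Ioo 0 ((a * r) ^ (1 / a)), ENNReal.ofReal (t ^ (a - 1)) :=
          (lintegral_Ioo_zero_rpow ha (by positivity)).symm
      _ ≤ _ := by
          refine lintegral_mono_set ?_
          intro t ht
          exact ⟨ENNReal.ofReal_lt_top, ht.1⟩
  | coe c =>
    have hset : {t : ℝ | ENNReal.ofReal t < c} ∩ Ioi 0 = Ioo 0 (c : ℝ) := by
      ext t
      simp only [mem_inter_iff, mem_ofPred_eq, mem_Ioi, mem_Ioo]
      constructor
      · rintro ⟨h, h0⟩
        rw [← ENNReal.ofReal_coe_nnreal, ENNReal.ofReal_lt_ofReal_iff_of_nonneg h0.le] at h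
        exact ⟨h0, h⟩
      · rintro ⟨h0, h⟩
        exact ⟨by rwa [← ENNReal.ofReal_coe_nnreal, ENNReal.ofReal_lt_ofReal_iff_of_nonneg h0.le], h0⟩
    rw [hset, lintegral_Ioo_zero_rpow ha c.coe_nonneg, ENNReal.ofReal_div_of_pos ha,
      ← ENNReal.ofReal_rpow_of_nonneg c.coe_nonneg ha.le, ENNReal.ofReal_coe_nnreal]

/-- Interpolation between a small power near zero and a negative power near infinity. -/
lemma lintegral_Ioi_min_rpow_le {a b : ℝ} (ha : 0 < a) (hb : 0 < b) (A B : ℝ≥0∞) :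
    ∫⁻ t in Ioi (0 : ℝ), min (ENNReal.ofReal (t ^ (a - 1)) * A) (ENNReal.ofReal (t ^ (-b - 1)) * B)
      ≤ ENNReal.ofReal (1 / a + 1 / b) * (A ^ (b / (a + b)) * B ^ (a / (a + b))) := by
  have hα : 0 < b / (a + b) := by positivity
  have hβ : 0 < a / (a + b) := by positivity
  rcases eq_or_ne A 0 with rfl | hA0
  · simp
  rcases eq_or_ne B 0 with rfl | hB0
  · simp
  have hC : ENNReal.ofReal (1 / a + 1 / b) ≠ 0 := by
    rw [ne_eq, ENNReal.ofReal_eq_zero, not_le]; positivity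
  rcases eq_or_ne A ∞ with rfl | hA
  · rw [ENNReal.top_rpow_of_pos hα, ENNReal.top_mul, ENNReal.mul_top hC]
    · exact le_top
    · simp [hβ.le, hβ, hB0]
  rcases eq_or_ne B ∞ with rfl | hB
  · rw [ENNReal.top_rpow_of_pos hβ, ENNReal.mul_top, ENNReal.mul_top hC]
    · exact le_top
    · simp [hα.le, hα, hA0]
  obtain ⟨x, hx, rfl⟩ : ∃ x : ℝ, 0 < x ∧ ENNReal.ofReal x = A :=
    ⟨A.toReal, ENNReal.toReal_pos hA0 hA, ENNReal.ofReal_toReal hA⟩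
  obtain ⟨y, hy, rfl⟩ : ∃ y : ℝ, 0 < y ∧ ENNReal.ofReal y = B :=
    ⟨B.toReal, ENNReal.toReal_pos hB0 hB, ENNReal.ofReal_toReal hB⟩
  set R : ℝ := (y / x) ^ (1 / (a + b)) with hRdef
  have hR : 0 < R := by positivity
  have hRa : R ^ a * x = x ^ (b / (a + b)) * y ^ (a / (a + b)) := by
    rw [hRdef, ← Real.rpow_mul (by positivity), one_div_mul_eq_div, Real.div_rpow hy.le hx.le,
      show b / (a + b) = 1 - a / (a + b) by field_simp; ring, Real.rpow_sub hx, Real.rpow_one]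
    ring
  have hRb : R ^ (-b) * y = x ^ (b / (a + b)) * y ^ (a / (a + b)) := by
    rw [hRdef, ← Real.rpow_mul (by positivity), one_div_mul_eq_div, neg_div,
      Real.rpow_neg (by positivity), Real.div_rpow hy.le hx.le,
      show a / (a + b) = 1 - b / (a + b) by field_simp; ring, Real.rpow_sub hy, Real.rpow_one]
    field_simp
  have hunion : Ioi (0 : ℝ) ⊆ Ioo 0 R ∪ Ici R := fun t ht =>
    (lt_or_ge t R).imp (fun h => ⟨ht, h⟩) id
  calc _ ≤ ∫⁻ t in Ioo 0 R ∪ Ici R, min (ENNReal.ofReal (t ^ (a - 1)) * ENNReal.ofReal x)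
          (ENNReal.ofReal (t ^ (-b - 1)) * ENNReal.ofReal y) := lintegral_mono_set hunion
    _ ≤ _ := lintegral_union_le _ _ _
    _ ≤ (∫⁻ t in Ioo 0 R, ENNReal.ofReal (t ^ (a - 1)) * ENNReal.ofReal x) +
          ∫⁻ t in Ici R, ENNReal.ofReal (t ^ (-b - 1)) * ENNReal.ofReal y :=
        add_le_add (lintegral_mono fun t => min_le_left _ _) (lintegral_mono fun t => min_le_right _ _)
    _ = ENNReal.ofReal (R ^ a / a) * ENNReal.ofReal x +
          ENNReal.ofReal (R ^ (-b) / b) * ENNReal.ofReal y := by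
        rw [lintegral_mul_const' _ _ ENNReal.ofReal_ne_top,
          lintegral_mul_const' _ _ ENNReal.ofReal_ne_top, lintegral_Ioo_zero_rpow ha hR.le,
          ← setLIntegral_congr Ioi_ae_eq_Ici, lintegral_Ioi_rpow hb hR]
    _ = ENNReal.ofReal ((1 / a + 1 / b) * (x ^ (b / (a + b)) * y ^ (a / (a + b)))) := by
        rw [← ENNReal.ofReal_mul (by positivity), ← ENNReal.ofReal_mul (by positivity),
          ← ENNReal.ofReal_add (by positivity) (by positivity), add_mul]
        congr 2
        · rw [← hRa]; ring
        · rw [← hRb]; ring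
    _ = _ := by
        rw [ENNReal.ofReal_mul (by positivity), ENNReal.ofReal_mul (by positivity),
          ENNReal.ofReal_rpow_of_pos hx, ENNReal.ofReal_rpow_of_pos hy]

/-- Hölder's inequality against the indicator function of a set. -/
lemma setLIntegral_le_rpow_mul_measure_rpow {α : Type*} [MeasurableSpace α] (μ : Measure α)
    {p : ℝ} (hp : 1 < p) {g : α → ℝ≥0∞} (hg : Measurable g) (s : Set α) :
    ∫⁻ x in s, g x ∂μ ≤ (∫⁻ x, g x ^ p ∂μ) ^ (1 / p) * μ s ^ (1 - 1 / p) := by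
  have hpq := Real.HolderConjugate.conjExponent hp
  have h := ENNReal.lintegral_mul_le_Lp_mul_Lq (μ.restrict s) hpq hg.aemeasurable
    (aemeasurable_const (b := (1 : ℝ≥0∞)))
  simp only [Pi.mul_apply, mul_one, ENNReal.one_rpow, lintegral_one,
    Measure.restrict_apply_univ] at h
  rw [one_div p.conjExponent, ← hpq.one_sub_inv, ← one_div p] at h
  refine h.trans ?_
  gcongr
  exact Measure.restrict_le_self

section MaximalFunction

variable {E : Type*} [NormedAddCommGroup E] [MeasurableSpace E]

/-- The centered Hardy–Littlewood maximal function, taken over closed balls of rational radius. -/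
noncomputable def hardyLittlewoodMaximal (μ : Measure E) (F : E → ℝ≥0∞) (x : E) : ℝ≥0∞ :=
  ⨆ r : {r : ℚ // 0 < r}, (∫⁻ y in closedBall x (r : ℚ), F y ∂μ) / μ (closedBall x (r : ℚ))

lemma hardyLittlewoodMaximal_le_add [NormedSpace ℝ E] [FiniteDimensional ℝ E]
    (μ : Measure E) [μ.IsAddHaarMeasure] {F G : E → ℝ≥0∞} (hG : Measurable G) {c : ℝ≥0∞}
    (h : ∀ y, F y ≤ G y + c) (x : E) :
    hardyLittlewoodMaximal μ F x ≤ hardyLittlewoodMaximal μ G x + c := by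
  refine iSup_le fun r => ?_
  have hr0 : (0 : ℝ) < (r : ℚ) := by exact_mod_cast r.2
  calc (∫⁻ y in closedBall x (r : ℚ), F y ∂μ) / μ (closedBall x (r : ℚ))
      ≤ ((∫⁻ y in closedBall x (r : ℚ), G y ∂μ) + c * μ (closedBall x (r : ℚ))) /
          μ (closedBall x (r : ℚ)) := by
        gcongr
        rw [← setLIntegral_const, ← lintegral_add_left hG]
        exact lintegral_mono h
    _ = (∫⁻ y in closedBall x (r : ℚ), G y ∂μ) / μ (closedBall x (r : ℚ)) + c := by
        rw [ENNReal.add_div, ENNReal.mul_div_cancel_right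
          (measure_closedBall_pos μ x hr0).ne' measure_closedBall_lt_top.ne]
    _ ≤ _ := by
        gcongr
        exact le_iSup (fun r : {r : ℚ // 0 < r} =>
          (∫⁻ y in closedBall x (r : ℚ), G y ∂μ) / μ (closedBall x (r : ℚ))) r

variable [BorelSpace E]

lemma measurable_setLIntegral_closedBall [SecondCountableTopology E] (μ : Measure E) [SFinite μ]
    {F : E → ℝ≥0∞} (hF : Measurable F) (r : ℝ) :
    Measurable fun x => ∫⁻ y in closedBall x r, F y ∂μ := by
  have h : Measurable fun z : E × E => {z : E × E | dist z.2 z.1 ≤ r}.indicator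
      (fun z => F z.2) z :=
    (hF.comp measurable_snd).indicator
      (measurableSet_le (measurable_snd.dist measurable_fst) measurable_const)
  convert h.lintegral_prod_right' (ν := μ) using 2 with x
  rw [← lintegral_indicator measurableSet_closedBall]
  rfl

variable [NormedSpace ℝ E] [FiniteDimensional ℝ E] (μ : Measure E) [μ.IsAddHaarMeasure]

lemma measurable_hardyLittlewoodMaximal {F : E → ℝ≥0∞} (hF : Measurable F) :
    Measurable (hardyLittlewoodMaximal μ F) := by
  have := FiniteDimensional.proper ℝ E
  refine Measurable.iSup fun r => ?_
  simp_rw [Measure.addHaar_closedBall_center μ]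
  exact (measurable_setLIntegral_closedBall μ hF _).div_const _

/-- Averages over arbitrary closed balls are controlled by the maximal function. -/
lemma setLIntegral_closedBall_le_hardyLittlewoodMaximal (F : E → ℝ≥0∞) (x : E) {t : ℝ}
    (ht : 0 < t) :
    ∫⁻ y in closedBall x t, F y ∂μ ≤ ENNReal.ofReal (t ^ finrank ℝ E) *
      (2 ^ finrank ℝ E * μ (ball 0 1) * hardyLittlewoodMaximal μ F x) := by
  obtain ⟨r, htr, hrt⟩ := exists_rat_btwn (show t < 2 * t by linarith)
  have hr : (0 : ℝ) < r := ht.trans htr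
  have hball : μ (closedBall x r) ≠ 0 := (measure_closedBall_pos μ x hr).ne'
  have hball' : μ (closedBall x r) ≠ ∞ := measure_closedBall_lt_top.ne
  calc ∫⁻ y in closedBall x t, F y ∂μ ≤ ∫⁻ y in closedBall x r, F y ∂μ :=
        lintegral_mono_set (closedBall_subset_closedBall htr.le)
    _ = (∫⁻ y in closedBall x r, F y ∂μ) / μ (closedBall x r) * μ (closedBall x r) :=
        (ENNReal.div_mul_cancel hball hball').symm
    _ ≤ hardyLittlewoodMaximal μ F x * μ (closedBall x r) := by
        gcongr
        exact le_iSup (fun r : {r : ℚ // 0 < r} =>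
          (∫⁻ y in closedBall x (r : ℚ), F y ∂μ) / μ (closedBall x (r : ℚ)))
          ⟨r, by exact_mod_cast hr⟩
    _ ≤ hardyLittlewoodMaximal μ F x *
          (ENNReal.ofReal ((2 * t) ^ finrank ℝ E) * μ (ball 0 1)) := by
        rw [Measure.addHaar_closedBall μ x hr.le]
        gcongr
    _ = _ := by
        rw [mul_pow, ENNReal.ofReal_mul (by positivity), ENNReal.ofReal_pow (by norm_num),
          ENNReal.ofReal_ofNat]
        ring

/-- The weak type (1,1) inequality for the maximal function. -/
lemma mul_measure_lt_hardyLittlewoodMaximal_le [Nontrivial E] (F : E → ℝ≥0∞) {c : ℝ≥0∞}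
    (hc : c ≠ 0) :
    c * μ {x | c < hardyLittlewoodMaximal μ F x} ≤ 5 ^ finrank ℝ E * ∫⁻ y, F y ∂μ := by
  rcases eq_or_ne c ∞ with rfl | hc'
  · simp
  rcases eq_or_ne (∫⁻ y, F y ∂μ) ∞ with hF | hF
  · rw [hF, ENNReal.mul_top (by positivity)]
    exact le_top
  have := FiniteDimensional.proper ℝ E
  set S := {x | c < hardyLittlewoodMaximal μ F x} with hS
  have hex : ∀ x ∈ S, ∃ r : ℝ, 0 < r ∧
      c * μ (closedBall x r) ≤ ∫⁻ y in closedBall x r, F y ∂μ := by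
    intro x hx
    obtain ⟨r, hr⟩ := lt_iSup_iff.1 (show c < hardyLittlewoodMaximal μ F x from hx)
    have hr0 : (0 : ℝ) < (r : ℚ) := by exact_mod_cast r.2
    exact ⟨(r : ℚ), hr0, (ENNReal.le_div_iff_mul_le
      (.inl (measure_closedBall_pos μ x hr0).ne') (.inl measure_closedBall_lt_top.ne)).1 hr.le⟩
  choose! r hr0 hr using hex
  have hd : 1 ≤ finrank ℝ E := finrank_pos
  have hV : μ (ball (0 : E) 1) ≠ 0 := (measure_ball_pos μ 0 one_pos).ne'
  have hV' : μ (ball (0 : E) 1) ≠ ∞ := measure_ball_lt_top.ne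
  set K : ℝ≥0∞ := (∫⁻ y, F y ∂μ) / (c * μ (ball 0 1)) with hK
  have hK' : K ≠ ∞ := ENNReal.div_ne_top hF (mul_ne_zero hc hV)
  have hbound : ∀ x ∈ S, r x ≤ max 1 K.toReal := by
    intro x hx
    rcases le_total (r x) 1 with h1 | h1
    · exact le_max_of_le_left h1
    refine le_max_of_le_right ?_
    refine (le_self_pow₀ h1 (Nat.one_le_iff_ne_zero.1 hd)).trans
      ((ENNReal.ofReal_le_iff_le_toReal hK').1 ?_)
    rw [hK, ENNReal.le_div_iff_mul_le (.inl (mul_ne_zero hc hV)) (.inl (ENNReal.mul_ne_top hc' hV'))]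
    calc _ = c * μ (closedBall x (r x)) := by
          rw [Measure.addHaar_closedBall μ x (hr0 x hx).le]; ring
      _ ≤ _ := (hr x hx).trans (setLIntegral_le_lintegral _ _)
  obtain ⟨u, huS, hdisj, hcov⟩ := Vitali.exists_disjoint_subfamily_covering_enlargement_closedBall
    S id r _ hbound 5 (by norm_num)
  simp only [id] at hdisj hcov
  have hu : u.Countable := hdisj.countable_of_nonempty_interior fun x hx =>
    (nonempty_ball.2 (hr0 x (huS hx))).mono ball_subset_interior_closedBall
  have hsub : S ⊆ ⋃ x ∈ u, closedBall x (5 * r x) := by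
    intro x hx
    obtain ⟨b, hb, h⟩ := hcov x hx
    exact mem_biUnion hb (h (mem_closedBall_self (hr0 x hx).le))
  calc c * μ S ≤ c * ∑' x : u, μ (closedBall (x : E) (5 * r x)) := by
        gcongr
        exact (measure_mono hsub).trans (measure_biUnion_le μ hu _)
    _ = ∑' x : u, 5 ^ finrank ℝ E * (c * μ (closedBall (x : E) (r x))) := by
        rw [← ENNReal.tsum_mul_left]
        congr 1 with x
        have h0 := (hr0 x (huS x.2)).le
        rw [Measure.addHaar_closedBall μ _ h0, Measure.addHaar_closedBall μ _ (by positivity),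
          mul_pow, ENNReal.ofReal_mul (by positivity), ENNReal.ofReal_pow (by norm_num),
          ENNReal.ofReal_ofNat]
        ring
    _ ≤ ∑' x : u, 5 ^ finrank ℝ E * ∫⁻ y in closedBall (x : E) (r x), F y ∂μ := by
        gcongr with x
        exact hr x (huS x.2)
    _ = 5 ^ finrank ℝ E * ∫⁻ y in ⋃ x ∈ u, closedBall x (r x), F y ∂μ := by
        rw [ENNReal.tsum_mul_left, lintegral_biUnion hu (fun _ _ => measurableSet_closedBall) hdisj]
    _ ≤ _ := by
        gcongr
        exact Measure.restrict_le_self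

lemma mul_measure_lt_hardyLittlewoodMaximal_le_setLIntegral [Nontrivial E] {F : E → ℝ≥0∞}
    (hF : Measurable F) {c : ℝ≥0∞} (hc : c ≠ 0) :
    c * μ {x | c < hardyLittlewoodMaximal μ F x} ≤
      2 * 5 ^ finrank ℝ E * ∫⁻ y in {y | c < 2 * F y}, F y ∂μ := by
  have hmeas : MeasurableSet {y | c < 2 * F y} := measurableSet_lt measurable_const (hF.const_mul 2)
  have hle : ∀ y, F y ≤ {y | c < 2 * F y}.indicator F y + c / 2 := by
    intro y
    by_cases hy : c < 2 * F y
    · rw [indicator_of_mem (show y ∈ {y | c < 2 * F y} from hy)]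
      exact le_self_add
    · refine le_add_of_nonneg_of_le zero_le ?_
      rw [ENNReal.le_div_iff_mul_le (by simp) (by simp), mul_comm]
      exact not_lt.1 hy
  have hsub : {x | c < hardyLittlewoodMaximal μ F x} ⊆
      {x | c / 2 < hardyLittlewoodMaximal μ ({y | c < 2 * F y}.indicator F) x} := by
    intro x hx
    by_contra hcon
    have h1 := hardyLittlewoodMaximal_le_add μ (hF.indicator hmeas) hle x
    have h2 : hardyLittlewoodMaximal μ F x ≤ c / 2 + c / 2 :=
      h1.trans (add_le_add_left (not_lt.1 hcon) _)
    rw [ENNReal.add_halves] at h2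
    exact absurd hx (not_lt.2 h2)
  calc c * μ {x | c < hardyLittlewoodMaximal μ F x}
      = 2 * (c / 2 * μ {x | c < hardyLittlewoodMaximal μ F x}) := by
        rw [← mul_assoc, ENNReal.mul_div_cancel (by simp) (by simp)]
    _ ≤ 2 * (5 ^ finrank ℝ E * ∫⁻ y, {y | c < 2 * F y}.indicator F y ∂μ) := by
        refine mul_le_mul_right (le_trans ?_
          (mul_measure_lt_hardyLittlewoodMaximal_le μ _ (c := c / 2) (by simpa using hc))) _
        gcongr
    _ = _ := by rw [lintegral_indicator hmeas, mul_assoc]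

/-- The strong type (p,p) inequality for the maximal function. -/
lemma exists_lintegral_hardyLittlewoodMaximal_rpow_le [Nontrivial E] {p : ℝ} (hp : 1 < p) :
    ∃ C : ℝ≥0∞, C ≠ ∞ ∧ ∀ F : E → ℝ≥0∞, Measurable F →
      ∫⁻ x, hardyLittlewoodMaximal μ F x ^ p ∂μ ≤ C * ∫⁻ x, F x ^ p ∂μ := by
  have hp0 : 0 < p := by linarith
  refine ⟨ENNReal.ofReal p * (2 * 5 ^ finrank ℝ E * (2 ^ (p - 1) / ENNReal.ofReal (p - 1))), ?_,
    fun F hF => ?_⟩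
  · refine ENNReal.mul_ne_top ENNReal.ofReal_ne_top (ENNReal.mul_ne_top (ENNReal.mul_ne_top
      (by simp) (by simp)) (ENNReal.div_ne_top (by simp) ?_))
    simpa using hp
  have := FiniteDimensional.proper ℝ E
  have hM := measurable_hardyLittlewoodMaximal μ hF
  have hpow (a : ℝ) : Measurable fun t : ℝ => ENNReal.ofReal (t ^ a) :=
    (measurable_id.pow_const a).ennreal_ofReal
  calc ∫⁻ x, hardyLittlewoodMaximal μ F x ^ p ∂μ
      = ∫⁻ x, ENNReal.ofReal p * (∫⁻ t in Ioi (0 : ℝ),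
          {t : ℝ | ENNReal.ofReal t < hardyLittlewoodMaximal μ F x}.indicator
            (fun t => ENNReal.ofReal (t ^ (p - 1))) t) ∂μ := by
        congr 1 with x
        rw [lintegral_indicator_ofReal_lt_rpow hp0, ENNReal.mul_div_cancel (by simpa using hp0)
          ENNReal.ofReal_ne_top]
    _ = ENNReal.ofReal p * ∫⁻ t in Ioi (0 : ℝ), ∫⁻ x,
          {x : E | ENNReal.ofReal t < hardyLittlewoodMaximal μ F x}.indicator
            (fun _ => ENNReal.ofReal (t ^ (p - 1))) x ∂μ := by
        rw [lintegral_const_mul' _ _ ENNReal.ofReal_ne_top, lintegral_lintegral_swap]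
        · rfl
        · refine Measurable.aemeasurable ?_
          exact ((hpow (p - 1)).comp measurable_snd).indicator
            (measurableSet_lt (ENNReal.measurable_ofReal.comp measurable_snd)
              (hM.comp measurable_fst))
    _ ≤ ENNReal.ofReal p * ∫⁻ t in Ioi (0 : ℝ), 2 * 5 ^ finrank ℝ E * ∫⁻ x,
          {x : E | ENNReal.ofReal t < 2 * F x}.indicator
            (fun x => ENNReal.ofReal (t ^ (p - 1 - 1)) * F x) x ∂μ := by
        refine mul_le_mul_right (setLIntegral_mono' measurableSet_Ioi fun t ht => ?_) _
        rw [lintegral_indicator (measurableSet_lt measurable_const hM), setLIntegral_const,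
          lintegral_indicator (measurableSet_lt measurable_const (hF.const_mul 2)),
          lintegral_const_mul' _ _ ENNReal.ofReal_ne_top]
        have ht0 : (0 : ℝ) < t := ht
        have ht' : t ^ (p - 1) = t ^ (p - 1 - 1) * t := by
          rw [← Real.rpow_add_one ht0.ne', sub_add_cancel]
        rw [ht', ENNReal.ofReal_mul (by positivity), mul_assoc, mul_left_comm (2 * _)]
        exact mul_le_mul_right (mul_measure_lt_hardyLittlewoodMaximal_le_setLIntegral μ hF
          (by simpa using ht0)) _
    _ = ENNReal.ofReal p * (2 * 5 ^ finrank ℝ E * ∫⁻ x, (∫⁻ t in Ioi (0 : ℝ),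
          {t : ℝ | ENNReal.ofReal t < 2 * F x}.indicator
            (fun t => ENNReal.ofReal (t ^ (p - 1 - 1))) t * F x) ∂μ) := by
        rw [lintegral_const_mul' _ _ (ENNReal.mul_ne_top (by simp) (by simp)),
          lintegral_lintegral_swap]
        · congr 3 with x
          congr 1 with t
          simp only [indicator_apply, mem_ofPred_eq]
          split_ifs <;> simp
        · refine Measurable.aemeasurable ?_
          exact (((hpow (p - 1 - 1)).comp measurable_fst).mul (hF.comp measurable_snd)).indicator
            (measurableSet_lt (ENNReal.measurable_ofReal.comp measurable_fst)
              ((hF.comp measurable_snd).const_mul 2))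
    _ = ENNReal.ofReal p * (2 * 5 ^ finrank ℝ E * ∫⁻ x, 2 ^ (p - 1) / ENNReal.ofReal (p - 1) *
          F x ^ p ∂μ) := by
        congr 3 with x
        rw [lintegral_mul_const, lintegral_indicator_ofReal_lt_rpow (by linarith),
          ENNReal.mul_rpow_of_nonneg _ _ (by linarith)]
        · have : F x ^ p = F x ^ (p - 1) * F x := by
            conv_rhs => rw [← ENNReal.rpow_one (F x), ← ENNReal.rpow_mul, one_mul,
              ← ENNReal.rpow_add_of_nonneg _ _ (by linarith) zero_le_one, sub_add_cancel]
          rw [this, div_eq_mul_inv, div_eq_mul_inv]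
          ring
        · exact (hpow _).indicator
            (measurableSet_lt ENNReal.measurable_ofReal measurable_const)
    _ = _ := by
        rw [lintegral_const_mul _ (hF.pow_const p)]
        ring

end MaximalFunction

lemma ofReal_rpow_neg_le_lintegral {d : ℝ} (hd : 0 < d) {ρ : ℝ} (hρ : 0 ≤ ρ) :
    ENNReal.ofReal (ρ ^ (-d)) ≤ ENNReal.ofReal d * ∫⁻ t in Ioi (0 : ℝ),
      {t : ℝ | ρ ≤ t}.indicator (fun t => ENNReal.ofReal (t ^ (-d - 1))) t := by
  rcases hρ.eq_or_lt with rfl | hρ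
  · simp [Real.zero_rpow (neg_ne_zero.2 hd.ne')]
  calc ENNReal.ofReal (ρ ^ (-d))
      = ENNReal.ofReal d * ∫⁻ t in Ioi ρ, ENNReal.ofReal (t ^ (-d - 1)) := by
        rw [lintegral_Ioi_rpow hd hρ, ← ENNReal.ofReal_mul hd.le, mul_div_cancel₀ _ hd.ne']
    _ ≤ _ := by
        have hmeas : MeasurableSet {t : ℝ | ρ ≤ t} := measurableSet_Ici
        rw [setLIntegral_indicator hmeas]
        refine mul_le_mul_right (lintegral_mono_set ?_) _
        intro t ht
        exact ⟨Ioi_subset_Ici_self ht, hρ.trans ht⟩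

section Kernel

variable {E S : Type*} [NormedAddCommGroup E] [NormedSpace ℝ E] [FiniteDimensional ℝ E]
  [MeasurableSpace E] [BorelSpace E] [NormedAddCommGroup S] [NormedSpace ℝ S]
  [FiniteDimensional ℝ S] [MeasurableSpace S] [BorelSpace S]
  (μ : Measure E) [μ.IsAddHaarMeasure] (ν : Measure S) [ν.IsAddHaarMeasure]

/-- A negative power of `‖x - y‖ + ‖s‖` is a superposition of indicators of products of balls. -/
lemma lintegral_kernel_mul_le {d : ℝ} (hd : 0 < d) {g : E × S → ℝ≥0∞} (hg : Measurable g) (x : E) :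
    ∫⁻ y, ∫⁻ s, ENNReal.ofReal ((‖x - y‖ + ‖s‖) ^ (-d)) * g (y, s) ∂ν ∂μ ≤
      ENNReal.ofReal d * ∫⁻ t in Ioi (0 : ℝ), ENNReal.ofReal (t ^ (-d - 1)) *
        ∫⁻ y in closedBall x t, ∫⁻ s in closedBall 0 t, g (y, s) ∂ν ∂μ := by
  have := FiniteDimensional.proper ℝ E
  have := FiniteDimensional.proper ℝ S
  have hρ : Measurable fun z : E × S => ‖x - z.1‖ + ‖z.2‖ := by fun_prop
  have hpow (a : ℝ) : Measurable fun t : ℝ => ENNReal.ofReal (t ^ a) :=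
    (measurable_id.pow_const a).ennreal_ofReal
  calc ∫⁻ y, ∫⁻ s, ENNReal.ofReal ((‖x - y‖ + ‖s‖) ^ (-d)) * g (y, s) ∂ν ∂μ
      = ∫⁻ z, ENNReal.ofReal ((‖x - z.1‖ + ‖z.2‖) ^ (-d)) * g z ∂μ.prod ν :=
        (lintegral_prod _ (((hρ.pow_const _).ennreal_ofReal.mul hg).aemeasurable)).symm
    _ ≤ ∫⁻ z, ENNReal.ofReal d * (∫⁻ t in Ioi (0 : ℝ),
          {t : ℝ | ‖x - z.1‖ + ‖z.2‖ ≤ t}.indicator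
            (fun t => ENNReal.ofReal (t ^ (-d - 1))) t * g z) ∂μ.prod ν := by
        refine lintegral_mono fun z => ?_
        have hmeas : MeasurableSet {t : ℝ | ‖x - z.1‖ + ‖z.2‖ ≤ t} := measurableSet_Ici
        rw [lintegral_mul_const _ ((hpow _).indicator hmeas), ← mul_assoc]
        gcongr
        exact ofReal_rpow_neg_le_lintegral hd (by positivity)
    _ = ENNReal.ofReal d * ∫⁻ t in Ioi (0 : ℝ), ∫⁻ z,
          {t : ℝ | ‖x - z.1‖ + ‖z.2‖ ≤ t}.indicator
            (fun t => ENNReal.ofReal (t ^ (-d - 1))) t * g z ∂μ.prod ν := by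
        rw [lintegral_const_mul' _ _ ENNReal.ofReal_ne_top, lintegral_lintegral_swap]
        refine Measurable.aemeasurable ?_
        exact (((hpow (-d - 1)).comp measurable_snd).indicator
          (measurableSet_le (hρ.comp measurable_fst) measurable_snd)).mul (hg.comp measurable_fst)
    _ ≤ _ := by
        refine mul_le_mul_right (lintegral_mono fun t => ?_) _
        have hball : MeasurableSet (closedBall x t ×ˢ closedBall (0 : S) t) :=
          measurableSet_closedBall.prod measurableSet_closedBall
        rw [← setLIntegral_prod _ hg.aemeasurable, ← lintegral_const_mul' _ _ ENNReal.ofReal_ne_top,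
          ← lintegral_indicator hball]
        refine lintegral_mono fun z => ?_
        by_cases hz : ‖x - z.1‖ + ‖z.2‖ ≤ t
        · have hmem : z ∈ closedBall x t ×ˢ closedBall (0 : S) t := by
            refine ⟨?_, ?_⟩
            · rw [mem_closedBall', dist_eq_norm]
              linarith [norm_nonneg z.2]
            · rw [mem_closedBall_zero_iff]
              linarith [norm_nonneg (x - z.1)]
          rw [indicator_of_mem (show t ∈ {t : ℝ | ‖x - z.1‖ + ‖z.2‖ ≤ t} from hz),
            indicator_of_mem hmem]
        · rw [indicator_of_notMem (show t ∉ {t : ℝ | ‖x - z.1‖ + ‖z.2‖ ≤ t} from hz), zero_mul]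
          exact zero_le

lemma measure_closedBall_rpow (x : E) {t : ℝ} (ht : 0 ≤ t) {a : ℝ} (ha : 0 ≤ a) :
    μ (closedBall x t) ^ a = ENNReal.ofReal (t ^ (finrank ℝ E * a)) * μ (ball 0 1) ^ a := by
  rw [Measure.addHaar_closedBall μ x ht, ENNReal.mul_rpow_of_nonneg _ _ ha,
    ENNReal.ofReal_rpow_of_nonneg (by positivity) ha, ← Real.rpow_natCast, ← Real.rpow_mul ht]

/-- Hedberg's inequality for the operator with kernel `(‖x - y‖ + ‖s‖) ^ (-dim E)`. -/
lemma exists_lintegral_kernel_le_hardyLittlewoodMaximal [Nontrivial E] [Nontrivial S] {p q : ℝ}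
    (hp : 1 < p) (hq : 0 < q)
    (hpq : finrank ℝ S * (1 - 1 / p) + finrank ℝ E / q = finrank ℝ E / p) :
    ∃ C : ℝ≥0∞, C ≠ ∞ ∧ ∀ g : E × S → ℝ≥0∞, Measurable g → ∀ x,
      ∫⁻ y, ∫⁻ s, ENNReal.ofReal ((‖x - y‖ + ‖s‖) ^ (-(finrank ℝ E : ℝ))) * g (y, s) ∂ν ∂μ ≤
        C * (hardyLittlewoodMaximal μ (fun y => (∫⁻ s, g (y, s) ^ p ∂ν) ^ (1 / p)) x ^ (p / q) *
          ((∫⁻ z, g z ^ p ∂μ.prod ν) ^ (1 / p)) ^ (1 - p / q)) := by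
  have := FiniteDimensional.proper ℝ E
  have := FiniteDimensional.proper ℝ S
  have hp0 : 0 < p := by linarith
  have hp1 : 0 < 1 - 1 / p := by
    rw [sub_pos, div_lt_one hp0]; exact hp
  set d : ℝ := (finrank ℝ E : ℝ) with hd
  set k : ℝ := (finrank ℝ S : ℝ) with hk
  have hd0 : 0 < d := by rw [hd]; exact_mod_cast finrank_pos
  have hk0 : 0 < k := by rw [hk]; exact_mod_cast finrank_pos
  set a : ℝ := k * (1 - 1 / p) with ha
  set b : ℝ := d / q with hb
  have ha0 : 0 < a := by positivity
  have hb0 : 0 < b := by positivity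
  have hθ : b / (a + b) = p / q := by rw [hpq, hb]; field_simp
  have hθ' : a / (a + b) = 1 - p / q := by rw [← hθ]; field_simp; ring
  have hθ0 : 0 ≤ 1 - p / q := hθ' ▸ by positivity
  set K₁ : ℝ≥0∞ := ν (ball 0 1) ^ (1 - 1 / p) * (2 ^ finrank ℝ E * μ (ball 0 1)) with hK₁
  set K₂ : ℝ≥0∞ := ν (ball 0 1) ^ (1 - 1 / p) * μ (ball 0 1) ^ (1 - 1 / p) with hK₂
  have hV : ν (ball 0 1) ^ (1 - 1 / p) ≠ ∞ :=
    ENNReal.rpow_ne_top_of_nonneg hp1.le measure_ball_lt_top.ne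
  have hK₁' : K₁ ≠ ∞ := ENNReal.mul_ne_top hV
    (ENNReal.mul_ne_top (by simp) measure_ball_lt_top.ne)
  have hK₂' : K₂ ≠ ∞ := ENNReal.mul_ne_top hV
    (ENNReal.rpow_ne_top_of_nonneg hp1.le measure_ball_lt_top.ne)
  refine ⟨ENNReal.ofReal d * (ENNReal.ofReal (1 / a + 1 / b) *
    (K₁ ^ (p / q) * K₂ ^ (1 - p / q))), ?_, fun g hg x => ?_⟩
  · exact ENNReal.mul_ne_top ENNReal.ofReal_ne_top (ENNReal.mul_ne_top ENNReal.ofReal_ne_top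
      (ENNReal.mul_ne_top (ENNReal.rpow_ne_top_of_nonneg (by positivity) hK₁')
        (ENNReal.rpow_ne_top_of_nonneg hθ0 hK₂')))
  set F : E → ℝ≥0∞ := fun y => (∫⁻ s, g (y, s) ^ p ∂ν) ^ (1 / p) with hF
  have hFm : Measurable F := ((hg.pow_const p).lintegral_prod_right').pow_const _
  set N : ℝ≥0∞ := (∫⁻ z, g z ^ p ∂μ.prod ν) ^ (1 / p) with hN
  have hFN : (∫⁻ y, F y ^ p ∂μ) ^ (1 / p) = N := by
    rw [hN, lintegral_prod _ (hg.pow_const p).aemeasurable]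
    congr 2 with y
    rw [← ENNReal.rpow_mul, one_div_mul_cancel hp0.ne', ENNReal.rpow_one]
  set M := hardyLittlewoodMaximal μ F x with hM
  have hinner : ∀ t : ℝ, 0 < t →
      ENNReal.ofReal (t ^ (-d - 1)) *
        ∫⁻ y in closedBall x t, ∫⁻ s in closedBall 0 t, g (y, s) ∂ν ∂μ ≤
      min (ENNReal.ofReal (t ^ (a - 1)) * (K₁ * M))
        (ENNReal.ofReal (t ^ (-b - 1)) * (K₂ * N)) := by
    intro t ht
    have hslice : ∫⁻ y in closedBall x t, ∫⁻ s in closedBall 0 t, g (y, s) ∂ν ∂μ ≤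
        (∫⁻ y in closedBall x t, F y ∂μ) *
          (ENNReal.ofReal (t ^ a) * ν (ball 0 1) ^ (1 - 1 / p)) := by
      rw [← lintegral_mul_const _ hFm, ← measure_closedBall_rpow ν 0 ht.le hp1.le]
      exact lintegral_mono fun y => setLIntegral_le_rpow_mul_measure_rpow ν hp
        (hg.comp measurable_prodMk_left) _
    refine (mul_le_mul_right hslice _).trans (le_min ?_ ?_)
    · calc _ ≤ ENNReal.ofReal (t ^ (-d - 1)) * (ENNReal.ofReal (t ^ finrank ℝ E) *
              (2 ^ finrank ℝ E * μ (ball 0 1) * M) *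
                (ENNReal.ofReal (t ^ a) * ν (ball 0 1) ^ (1 - 1 / p))) := by
            gcongr
            exact setLIntegral_closedBall_le_hardyLittlewoodMaximal μ F x ht
        _ = ENNReal.ofReal (t ^ (-d - 1)) * ENNReal.ofReal (t ^ d) * ENNReal.ofReal (t ^ a) *
              (K₁ * M) := by
            rw [hd, Real.rpow_natCast, hK₁]; ring
        _ = _ := by
            rw [← ENNReal.ofReal_mul (by positivity), ← ENNReal.ofReal_mul (by positivity),
              ← Real.rpow_add ht, ← Real.rpow_add ht]
            ring_nf
    · calc _ ≤ ENNReal.ofReal (t ^ (-d - 1)) * (N * (ENNReal.ofReal (t ^ (d * (1 - 1 / p))) *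
              μ (ball 0 1) ^ (1 - 1 / p)) *
                (ENNReal.ofReal (t ^ a) * ν (ball 0 1) ^ (1 - 1 / p))) := by
            gcongr
            rw [← measure_closedBall_rpow μ x ht.le hp1.le, ← hFN]
            exact setLIntegral_le_rpow_mul_measure_rpow μ hp hFm _
        _ = ENNReal.ofReal (t ^ (-d - 1)) * ENNReal.ofReal (t ^ (d * (1 - 1 / p))) *
              ENNReal.ofReal (t ^ a) * (K₂ * N) := by
            rw [hK₂]; ring
        _ = _ := by
            rw [← ENNReal.ofReal_mul (by positivity), ← ENNReal.ofReal_mul (by positivity),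
              ← Real.rpow_add ht, ← Real.rpow_add ht,
              show -d - 1 + d * (1 - 1 / p) + a = -b - 1 by
                linear_combination hpq]
  calc _ ≤ _ := lintegral_kernel_mul_le μ ν hd0 hg x
    _ ≤ ENNReal.ofReal d * (ENNReal.ofReal (1 / a + 1 / b) *
          ((K₁ * M) ^ (b / (a + b)) * (K₂ * N) ^ (a / (a + b)))) :=
        mul_le_mul_right ((setLIntegral_mono' measurableSet_Ioi hinner).trans
          (lintegral_Ioi_min_rpow_le ha0 hb0 _ _)) _
    _ = _ := by
        rw [hθ, hθ', ENNReal.mul_rpow_of_nonneg _ _ (by positivity),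
          ENNReal.mul_rpow_of_nonneg _ _ hθ0]
        ring

/-- The operator with kernel `(‖x - y‖ + ‖s‖) ^ (-dim E)` is bounded from `L^p(E × S)` to `L^q(E)`. -/
theorem exists_lintegral_kernel_rpow_le [Nontrivial E] [Nontrivial S] {p q : ℝ}
    (hp : 1 < p) (hq : 0 < q)
    (hpq : finrank ℝ S * (1 - 1 / p) + finrank ℝ E / q = finrank ℝ E / p) :
    ∃ C : ℝ≥0∞, C ≠ ∞ ∧ ∀ g : E × S → ℝ≥0∞, Measurable g →
      (∫⁻ x, (∫⁻ y, ∫⁻ s, ENNReal.ofReal ((‖x - y‖ + ‖s‖) ^ (-(finrank ℝ E : ℝ))) *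
        g (y, s) ∂ν ∂μ) ^ q ∂μ) ^ (1 / q) ≤ C * (∫⁻ z, g z ^ p ∂μ.prod ν) ^ (1 / p) := by
  have := FiniteDimensional.proper ℝ E
  have := FiniteDimensional.proper ℝ S
  have hp0 : 0 < p := by linarith
  obtain ⟨C, hC, hpt⟩ := exists_lintegral_kernel_le_hardyLittlewoodMaximal μ ν hp hq hpq
  obtain ⟨A, hA, hmax⟩ := exists_lintegral_hardyLittlewoodMaximal_rpow_le μ hp
  have hpq' : p ≤ q := by
    have hd : (0 : ℝ) < finrank ℝ E := by exact_mod_cast finrank_pos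
    have h1 : 1 / p < 1 := (div_lt_one hp0).2 hp
    have h2 : (finrank ℝ E : ℝ) / q ≤ finrank ℝ E / p := by
      have : (0 : ℝ) ≤ finrank ℝ S * (1 - 1 / p) := by
        have : 0 ≤ 1 - 1 / p := by linarith
        positivity
      linarith
    exact (div_le_div_iff_of_pos_left hd hq hp0).1 h2
  refine ⟨C * A ^ (1 / q), ENNReal.mul_ne_top hC
    (ENNReal.rpow_ne_top_of_nonneg (by positivity) hA), fun g hg => ?_⟩
  set F : E → ℝ≥0∞ := fun y => (∫⁻ s, g (y, s) ^ p ∂ν) ^ (1 / p) with hF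
  have hFm : Measurable F := ((hg.pow_const p).lintegral_prod_right').pow_const _
  set J : ℝ≥0∞ := ∫⁻ z, g z ^ p ∂μ.prod ν with hJ
  have hFJ : ∫⁻ y, F y ^ p ∂μ = J := by
    rw [hJ, lintegral_prod _ (hg.pow_const p).aemeasurable]
    congr 1 with y
    rw [← ENNReal.rpow_mul, one_div_mul_cancel hp0.ne', ENNReal.rpow_one]
  rw [one_div q, ENNReal.rpow_inv_le_iff hq]
  calc _ ≤ ∫⁻ x, (C * (hardyLittlewoodMaximal μ F x ^ (p / q) *
          (J ^ (1 / p)) ^ (1 - p / q))) ^ q ∂μ :=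
        lintegral_mono fun x => ENNReal.rpow_le_rpow (hpt g hg x) hq.le
    _ = ∫⁻ x, hardyLittlewoodMaximal μ F x ^ p * (C ^ q * J ^ ((q - p) / p)) ∂μ := by
        congr 1 with x
        rw [ENNReal.mul_rpow_of_nonneg _ _ hq.le, ENNReal.mul_rpow_of_nonneg _ _ hq.le,
          ← ENNReal.rpow_mul, ← ENNReal.rpow_mul, ← ENNReal.rpow_mul, div_mul_cancel₀ _ hq.ne',
          show 1 / p * ((1 - p / q) * q) = (q - p) / p by field_simp]
        ring
    _ = (∫⁻ x, hardyLittlewoodMaximal μ F x ^ p ∂μ) * (C ^ q * J ^ ((q - p) / p)) :=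
        lintegral_mul_const _ ((measurable_hardyLittlewoodMaximal μ hFm).pow_const p)
    _ ≤ A * J * (C ^ q * J ^ ((q - p) / p)) := by
        gcongr
        exact hFJ ▸ hmax F hFm
    _ = C ^ q * A * (J ^ (1 : ℝ) * J ^ ((q - p) / p)) := by
        rw [ENNReal.rpow_one]; ring
    _ = _ := by
        rw [← ENNReal.rpow_add_of_nonneg _ _ zero_le_one (div_nonneg (by linarith) hp0.le),
          ENNReal.mul_rpow_of_nonneg _ _ hq.le, ENNReal.mul_rpow_of_nonneg _ _ hq.le,
          ← ENNReal.rpow_mul, ← ENNReal.rpow_mul, inv_mul_cancel₀ hq.ne', ENNReal.rpow_one,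
          show 1 + (q - p) / p = 1 / p * q by field_simp; ring]

end Kernel

/-- The codimension-2 Sobolev-trace-type bound for the kernel
`k(x, y, s) = (|x − y| + |s|)^{2−n}` on `ℝ^{n−2} × ℝ²`, mapping
`L^p(ℝ^n)` boundedly to `L^q(ℝ^{n−2})` when `n/p − (n−2)/q = 2`. -/
theorem stmt_2 (n : ℕ) (hn : 3 ≤ n) (p q : ℝ)
    (hp : 1 < p) (hq : 1 < q)
    (hpq : (n : ℝ) / p - ((n : ℝ) - 2) / q = 2) :
    ∃ C : ℝ, 0 ≤ C ∧
      ∀ f : (EuclideanSpace ℝ (Fin (n - 2)) × EuclideanSpace ℝ (Fin 2)) → ℝ,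
        Measurable f → (∀ z, 0 ≤ f z) →
          (∫⁻ x : EuclideanSpace ℝ (Fin (n - 2)),
              (∫⁻ y : EuclideanSpace ℝ (Fin (n - 2)), ∫⁻ s : EuclideanSpace ℝ (Fin 2),
                ENNReal.ofReal ((‖x - y‖ + ‖s‖) ^ (2 - (n : ℝ)) * f (y, s))) ^ q) ^ (1 / q)
            ≤ ENNReal.ofReal C *
              (∫⁻ z : EuclideanSpace ℝ (Fin (n - 2)) × EuclideanSpace ℝ (Fin 2),
                ENNReal.ofReal (f z) ^ p) ^ (1 / p) := by
  have hdim : 0 < n - 2 := by lia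
  have hcast : ((n - 2 : ℕ) : ℝ) = n - 2 := by
    rw [Nat.cast_sub (by lia)]; norm_num
  have : Nonempty (Fin (n - 2)) := ⟨⟨0, hdim⟩⟩
  have hexp : (finrank ℝ (EuclideanSpace ℝ (Fin 2)) : ℝ) * (1 - 1 / p) +
      finrank ℝ (EuclideanSpace ℝ (Fin (n - 2))) / q =
        finrank ℝ (EuclideanSpace ℝ (Fin (n - 2))) / p := by
    rw [finrank_euclideanSpace_fin, finrank_euclideanSpace_fin, hcast]
    push_cast
    linear_combination -hpq
  obtain ⟨C, hC, h⟩ := exists_lintegral_kernel_rpow_le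
    (volume : Measure (EuclideanSpace ℝ (Fin (n - 2))))
    (volume : Measure (EuclideanSpace ℝ (Fin 2))) hp (by linarith : 0 < q) hexp
  refine ⟨C.toReal, ENNReal.toReal_nonneg, fun f hf _ => ?_⟩
  have hmul (x y : EuclideanSpace ℝ (Fin (n - 2))) (s : EuclideanSpace ℝ (Fin 2)) :
      ENNReal.ofReal ((‖x - y‖ + ‖s‖) ^ (2 - (n : ℝ)) * f (y, s)) =
        ENNReal.ofReal ((‖x - y‖ + ‖s‖) ^ (-(finrank ℝ (EuclideanSpace ℝ (Fin (n - 2))) : ℝ))) *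
          ENNReal.ofReal (f (y, s)) := by
    rw [finrank_euclideanSpace_fin, hcast, neg_sub, ENNReal.ofReal_mul (by positivity)]
  simp_rw [hmul, ENNReal.ofReal_toReal hC]
  exact h (fun z => ENNReal.ofReal (f z)) hf.ennreal_ofReal
end
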